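/- arXiv:nlin/0510013 — 5 statements merged into one kernel-verified Lean document; each statement's English description precedes it below -/
import Mathlib

section
/- Suppose the family Ω satisfies the truncated Whitham hierarchy equations at every point. Then for every index A ∈ Fin n, the vector field X_A := e_A + (∂_x Ω_A)·e_p − (∂_p Ω_A)·e_x (the coordinate expression of the vector field ∂_A + ∂_xΩ_A ∂_p − ∂_pΩ_A ∂_x, where e_p is the unit vector in the p-direction, e_x the unit vector in the t 0 direction and e_A the unit vector in the t A direction) lies in the kernel of the Whitham 2-form: for every point q and every vector v ∈ ℂ × (Fin n → ℂ), Π_q(X_A(q), v) = 0. -/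
open scoped BigOperators

noncomputable section

/-- Partial derivative in the `p`-direction on `ℂ × (Fin n → ℂ)`. -/
def pDeriv {n : ℕ} (f : ℂ × (Fin n → ℂ) → ℂ) (q : ℂ × (Fin n → ℂ)) : ℂ :=
  fderiv ℂ f q (1, 0)

/-- Partial derivative in the `t A`-direction on `ℂ × (Fin n → ℂ)`. -/
def tDeriv {n : ℕ} (A : Fin n) (f : ℂ × (Fin n → ℂ) → ℂ) (q : ℂ × (Fin n → ℂ)) : ℂ :=
  fderiv ℂ f q (0, Pi.single A 1)

/-- The Whitham 2-form `Π = ∑_A δΩ_A ∧ dt_A` evaluated at `q` on a pair of vectors. -/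
def whithamForm {n : ℕ} (Ω : Fin n → ℂ × (Fin n → ℂ) → ℂ)
    (q u v : ℂ × (Fin n → ℂ)) : ℂ :=
  ∑ A : Fin n, (fderiv ℂ (Ω A) q u * v.2 A - fderiv ℂ (Ω A) q v * u.2 A)

/-- The derivative of `f` expanded in the coordinates `(p, t)`. -/
theorem fderiv_apply_eq_pDeriv_add_sum {n : ℕ} (f : ℂ × (Fin n → ℂ) → ℂ)
    (q v : ℂ × (Fin n → ℂ)) :
    fderiv ℂ f q v = pDeriv f q * v.1 + ∑ B, tDeriv B f q * v.2 B := by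
  have hv : v = v.1 • ((1 : ℂ), (0 : Fin n → ℂ))
      + ∑ B, v.2 B • ((0 : ℂ), (Pi.single B (1 : ℂ) : Fin n → ℂ)) := by
    ext i
    · simp [Prod.fst_sum]
    · simp [Prod.snd_sum, Finset.sum_apply, Pi.single_apply]
  conv_lhs => rw [hv]
  simp only [map_add, map_sum, map_smul, smul_eq_mul, pDeriv, tDeriv, mul_comm]

/-- The kernel of the Whitham 2-form contains the vector fields
`X_A = e_A + (∂_x Ω_A) e_p − (∂_p Ω_A) e_x`. -/
theorem whitham_kernel {n : ℕ} (hn : 0 < n)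
    (Ω : Fin n → ℂ × (Fin n → ℂ) → ℂ)
    (hdiff : ∀ A, Differentiable ℂ (Ω A))
    (hΩ0 : Ω ⟨0, hn⟩ = fun q => q.1)
    (hW : ∀ A B : Fin n, ∀ q : ℂ × (Fin n → ℂ),
      tDeriv A (Ω B) q - tDeriv B (Ω A) q +
        (tDeriv ⟨0, hn⟩ (Ω A) q * pDeriv (Ω B) q
          - pDeriv (Ω A) q * tDeriv ⟨0, hn⟩ (Ω B) q) = 0)
    (A : Fin n) (q v : ℂ × (Fin n → ℂ)) :
    whithamForm Ω q
      ((((0 : ℂ), Pi.single A (1 : ℂ)) : ℂ × (Fin n → ℂ))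
        + tDeriv ⟨0, hn⟩ (Ω A) q • (((1 : ℂ), (0 : Fin n → ℂ)) : ℂ × (Fin n → ℂ))
        - pDeriv (Ω A) q •
            (((0 : ℂ), Pi.single (⟨0, hn⟩ : Fin n) (1 : ℂ)) : ℂ × (Fin n → ℂ))) v = 0 := by
  set p₀ := pDeriv (Ω A) q
  have hcontract : ∀ B, fderiv ℂ (Ω B) q
      ((((0 : ℂ), Pi.single A (1 : ℂ)) : ℂ × (Fin n → ℂ))
        + tDeriv ⟨0, hn⟩ (Ω A) q • (((1 : ℂ), (0 : Fin n → ℂ)) : ℂ × (Fin n → ℂ))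
        - p₀ • (((0 : ℂ), Pi.single (⟨0, hn⟩ : Fin n) (1 : ℂ)) : ℂ × (Fin n → ℂ)))
      = tDeriv B (Ω A) q := by
    intro B
    simp only [map_sub, map_add, map_smul, smul_eq_mul]
    change tDeriv A (Ω B) q + tDeriv ⟨0, hn⟩ (Ω A) q * pDeriv (Ω B) q
      - p₀ * tDeriv ⟨0, hn⟩ (Ω B) q = _
    linear_combination hW A B q
  have hzero : fderiv ℂ (Ω ⟨0, hn⟩) q v = v.1 := by
    rw [hΩ0, fderiv_fst]
    rfl
  have hcoeff : ∑ B, fderiv ℂ (Ω B) q v *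
      ((Pi.single A (1 : ℂ) : Fin n → ℂ) B
        - p₀ * (Pi.single (⟨0, hn⟩ : Fin n) (1 : ℂ) : Fin n → ℂ) B)
      = fderiv ℂ (Ω A) q v - p₀ * v.1 := by
    simp [mul_sub, Finset.sum_sub_distrib, Pi.single_apply, hzero]
    ring
  simp only [whithamForm, hcontract, Finset.sum_sub_distrib]
  simp only [Prod.snd_sub, Prod.snd_add, Prod.smul_snd, Pi.sub_apply, Pi.add_apply,
    Pi.smul_apply, Pi.zero_apply, smul_eq_mul, mul_zero, add_zero]
  rw [hcoeff, fderiv_apply_eq_pDeriv_add_sum (Ω A) q v]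
  ring
end
end

section
/- The Whitham 2-form is simple if and only if the Whitham hierarchy holds: (Π∧Π)_q(u₁,u₂,u₃,u₄) = 0 for every point q and all vectors u₁,u₂,u₃,u₄ ∈ ℂ × (Fin n → ℂ) if and only if for all A, B ∈ Fin n and all points, ∂_A Ω_B − ∂_B Ω_A + (∂_x Ω_A · ∂_p Ω_B − ∂_p Ω_A · ∂_x Ω_B) = 0. -/
open scoped BigOperators

noncomputable section

/-- The wedge square `Π ∧ Π` of the Whitham 2-form, as a 4-linear form. -/
def whithamWedgeSq {n : ℕ} (Ω : Fin n → ℂ × (Fin n → ℂ) → ℂ)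
    (q u₁ u₂ u₃ u₄ : ℂ × (Fin n → ℂ)) : ℂ :=
  whithamForm Ω q u₁ u₂ * whithamForm Ω q u₃ u₄
    - whithamForm Ω q u₁ u₃ * whithamForm Ω q u₂ u₄
    + whithamForm Ω q u₁ u₄ * whithamForm Ω q u₂ u₃

/-- A Fréchet derivative on `ℂ × (Fin n → ℂ)` is determined by the partial derivatives. -/
theorem fderiv_apply_eq_pDeriv_add_sum_tDeriv {n : ℕ} (f : ℂ × (Fin n → ℂ) → ℂ)
    (q u : ℂ × (Fin n → ℂ)) :
    fderiv ℂ f q u = u.1 * pDeriv f q + ∑ B, u.2 B * tDeriv B f q := by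
  have hu : u = u.1 • ((1, 0) : ℂ × (Fin n → ℂ)) +
      ∑ B, u.2 B • ((0, Pi.single B 1) : ℂ × (Fin n → ℂ)) := by
    ext i
    · simp [Prod.fst_sum]
    · simp [Prod.snd_sum, Finset.sum_apply, Pi.single_apply]
  conv_lhs => rw [hu]
  simp only [map_add, map_sum, map_smul, smul_eq_mul, pDeriv, tDeriv]

/-- The Whitham 2-form in coordinates. -/
theorem whithamForm_eq_sum {n : ℕ} (Ω : Fin n → ℂ × (Fin n → ℂ) → ℂ)
    (q u v : ℂ × (Fin n → ℂ)) :
    whithamForm Ω q u v =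
      u.1 * (∑ A, pDeriv (Ω A) q * v.2 A) - v.1 * (∑ A, pDeriv (Ω A) q * u.2 A) +
        ∑ A, ∑ B, (tDeriv A (Ω B) q - tDeriv B (Ω A) q) * (u.2 A * v.2 B) := by
  have hswap : ∑ A, ∑ B, tDeriv A (Ω B) q * (u.2 A * v.2 B) =
      ∑ A, ∑ B, tDeriv B (Ω A) q * (u.2 B * v.2 A) := Finset.sum_comm
  simp only [sub_mul, Finset.sum_sub_distrib]
  rw [hswap]
  simp only [whithamForm, fderiv_apply_eq_pDeriv_add_sum_tDeriv, Finset.mul_sum,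
    ← Finset.sum_sub_distrib, ← Finset.sum_add_distrib]
  refine Finset.sum_congr rfl fun A _ => ?_
  simp only [add_mul, Finset.sum_mul, Finset.sum_sub_distrib]
  rw [Finset.sum_congr rfl fun B _ =>
      show u.2 B * tDeriv B (Ω A) q * v.2 A = tDeriv B (Ω A) q * (u.2 B * v.2 A) by ring,
    Finset.sum_congr rfl fun B _ =>
      show v.2 B * tDeriv B (Ω A) q * u.2 A = tDeriv B (Ω A) q * (u.2 A * v.2 B) by ring]
  ring

theorem whithamForm_p_t {n : ℕ} (Ω : Fin n → ℂ × (Fin n → ℂ) → ℂ)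
    (q : ℂ × (Fin n → ℂ)) (B : Fin n) :
    whithamForm Ω q (1, 0) (0, Pi.single B 1) = pDeriv (Ω B) q := by
  simp [whithamForm_eq_sum, Pi.single_apply]

theorem whithamForm_t_t {n : ℕ} (Ω : Fin n → ℂ × (Fin n → ℂ) → ℂ)
    (q : ℂ × (Fin n → ℂ)) (A B : Fin n) :
    whithamForm Ω q (0, Pi.single A 1) (0, Pi.single B 1) =
      tDeriv A (Ω B) q - tDeriv B (Ω A) q := by
  simp [whithamForm_eq_sum, Pi.single_apply]

theorem pDeriv_fst {n : ℕ} (q : ℂ × (Fin n → ℂ)) :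
    pDeriv (fun q : ℂ × (Fin n → ℂ) => q.1) q = 1 := by
  simp [pDeriv, fderiv_fst]

theorem tDeriv_fst {n : ℕ} (A : Fin n) (q : ℂ × (Fin n → ℂ)) :
    tDeriv A (fun q : ℂ × (Fin n → ℂ) => q.1) q = 0 := by
  simp [tDeriv, fderiv_fst]

/-- If the antisymmetrized `t`-derivatives are decomposable with `pDeriv (Ω ·)` as one factor,
then the Whitham 2-form is a wedge product of two 1-forms. -/
theorem whithamForm_eq_wedge {n : ℕ} (Ω : Fin n → ℂ × (Fin n → ℂ) → ℂ)
    (q : ℂ × (Fin n → ℂ)) (b : Fin n → ℂ)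
    (h : ∀ A B, tDeriv A (Ω B) q - tDeriv B (Ω A) q =
      pDeriv (Ω A) q * b B - b A * pDeriv (Ω B) q)
    (u v : ℂ × (Fin n → ℂ)) :
    whithamForm Ω q u v =
      (u.1 - ∑ A, b A * u.2 A) * (∑ A, pDeriv (Ω A) q * v.2 A) -
        (v.1 - ∑ A, b A * v.2 A) * (∑ A, pDeriv (Ω A) q * u.2 A) := by
  have hsum : ∑ A, ∑ B, (tDeriv A (Ω B) q - tDeriv B (Ω A) q) * (u.2 A * v.2 B) =
      (∑ A, pDeriv (Ω A) q * u.2 A) * (∑ B, b B * v.2 B) -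
        (∑ A, b A * u.2 A) * (∑ B, pDeriv (Ω B) q * v.2 B) := by
    simp only [Finset.sum_mul_sum, ← Finset.sum_sub_distrib]
    refine Finset.sum_congr rfl fun A _ => Finset.sum_congr rfl fun B _ => ?_
    rw [h]
    ring
  rw [whithamForm_eq_sum, hsum]
  ring

/-- The Whitham 2-form is simple (`Π ∧ Π = 0` everywhere) if and only if the
truncated Whitham hierarchy equations hold. -/
theorem whitham_simple_iff_hierarchy {n : ℕ} (hn : 0 < n)
    (Ω : Fin n → ℂ × (Fin n → ℂ) → ℂ)
    (hdiff : ∀ A, Differentiable ℂ (Ω A))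
    (hΩ0 : Ω ⟨0, hn⟩ = fun q => q.1) :
    (∀ q u₁ u₂ u₃ u₄ : ℂ × (Fin n → ℂ), whithamWedgeSq Ω q u₁ u₂ u₃ u₄ = 0) ↔
      (∀ A B : Fin n, ∀ q : ℂ × (Fin n → ℂ),
        tDeriv A (Ω B) q - tDeriv B (Ω A) q +
          (tDeriv ⟨0, hn⟩ (Ω A) q * pDeriv (Ω B) q
            - pDeriv (Ω A) q * tDeriv ⟨0, hn⟩ (Ω B) q) = 0) := by
  constructor
  · intro h A B q
    have key := h q (1, 0) (0, Pi.single ⟨0, hn⟩ 1) (0, Pi.single A 1) (0, Pi.single B 1)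
    simp only [whithamWedgeSq, whithamForm_p_t, whithamForm_t_t] at key
    rw [hΩ0, pDeriv_fst, tDeriv_fst, tDeriv_fst] at key
    linear_combination key
  · intro h q u₁ u₂ u₃ u₄
    have hwedge := whithamForm_eq_wedge Ω q (fun A => tDeriv ⟨0, hn⟩ (Ω A) q)
      fun A B => by linear_combination h A B q
    simp only [whithamWedgeSq, hwedge]
    ring
end
end

section
/- Let Ω_A, Ω_B, E : ℂ × (Fin n → ℂ) → ℂ be twice continuously differentiable, and suppose E satisfies the Lax-type equations ∂_C E = ∂_p Ω_C · ∂_x E − ∂_x Ω_C · ∂_p E at every point for C = A and C = B. Define W_{AB} := ∂_A Ω_B − ∂_B Ω_A + ∂_x Ω_A · ∂_p Ω_B − ∂_p Ω_A · ∂_x Ω_B (the left-hand side of the Whitham hierarchy equation for the pair A, B). Then at every point the Poisson bracket of W_{AB} with E vanishes: ∂_p W_{AB} · ∂_x E − ∂_x W_{AB} · ∂_p E = 0. (This expresses that the Whitham hierarchy equations are the compatibility conditions of the system ∂_A E = {E, Ω_A}.) -/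
open scoped BigOperators

noncomputable section

section DirectionalDerivative

variable {V : Type*} [NormedAddCommGroup V] [NormedSpace ℂ V]

lemma differentiableAt_fderiv_apply {f : V → ℂ} (hf : ContDiff ℂ 2 f) (v q : V) :
    DifferentiableAt ℂ (fun r => fderiv ℂ f r v) q :=
  ((hf.fderiv_right (m := 1) (by norm_num)).clm_apply contDiff_const).differentiable
    (by norm_num) q

lemma fderiv_fderiv_apply_comm {f : V → ℂ} (hf : ContDiff ℂ 2 f) (u v q : V) :
    fderiv ℂ (fun r => fderiv ℂ f r v) q u = fderiv ℂ (fun r => fderiv ℂ f r u) q v := by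
  have hd : DifferentiableAt ℂ (fderiv ℂ f) q :=
    (hf.fderiv_right (m := 1) (by norm_num)).differentiable (by norm_num) q
  have hsymm : IsSymmSndFDerivAt ℂ f q := hf.contDiffAt.isSymmSndFDerivAt (by simp)
  simpa [fderiv_clm_apply hd (differentiableAt_const _)] using hsymm u v

lemma fderiv_bracket_apply {f g h k : V → ℂ} {q : V} (hf : DifferentiableAt ℂ f q)
    (hg : DifferentiableAt ℂ g q) (hh : DifferentiableAt ℂ h q) (hk : DifferentiableAt ℂ k q)
    (w : V) :
    fderiv ℂ (fun r => f r * g r - h r * k r) q w =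
      fderiv ℂ f q w * g q + f q * fderiv ℂ g q w
        - (fderiv ℂ h q w * k q + h q * fderiv ℂ k q w) := by
  rw [fderiv_fun_sub (hf.fun_mul hg) (hh.fun_mul hk), fderiv_fun_mul hf hg, fderiv_fun_mul hh hk]
  simp only [sub_apply, add_apply,
    smul_apply, smul_eq_mul]
  ring

/-- The compatibility identity for two Lax equations along arbitrary directions `a`, `b`, with
the bracket taken in arbitrary directions `u`, `v`. -/
theorem bracket_compatibility (u v a b : V) {F G E : V → ℂ}
    (hF : ContDiff ℂ 2 F) (hG : ContDiff ℂ 2 G) (hE : ContDiff ℂ 2 E)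
    (hLaxF : ∀ q, fderiv ℂ E q a =
      fderiv ℂ F q u * fderiv ℂ E q v - fderiv ℂ F q v * fderiv ℂ E q u)
    (hLaxG : ∀ q, fderiv ℂ E q b =
      fderiv ℂ G q u * fderiv ℂ E q v - fderiv ℂ G q v * fderiv ℂ E q u) (q : V) :
    fderiv ℂ (fun r => fderiv ℂ G r a - fderiv ℂ F r b
        + fderiv ℂ F r v * fderiv ℂ G r u - fderiv ℂ F r u * fderiv ℂ G r v) q u
        * fderiv ℂ E q v
      - fderiv ℂ (fun r => fderiv ℂ G r a - fderiv ℂ F r b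
          + fderiv ℂ F r v * fderiv ℂ G r u - fderiv ℂ F r u * fderiv ℂ G r v) q v
        * fderiv ℂ E q u = 0 := by
  have dF := fun w => differentiableAt_fderiv_apply hF w q
  have dG := fun w => differentiableAt_fderiv_apply hG w q
  have dE := fun w => differentiableAt_fderiv_apply hE w q
  have hW (w : V) : fderiv ℂ (fun r => fderiv ℂ G r a - fderiv ℂ F r b
        + fderiv ℂ F r v * fderiv ℂ G r u - fderiv ℂ F r u * fderiv ℂ G r v) q w =
      fderiv ℂ (fun r => fderiv ℂ G r a) q w - fderiv ℂ (fun r => fderiv ℂ F r b) q w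
        + fderiv ℂ (fun r => fderiv ℂ F r v * fderiv ℂ G r u
            - fderiv ℂ F r u * fderiv ℂ G r v) q w := by
    simp only [add_sub_assoc]
    rw [fderiv_fun_add ((dG a).fun_sub (dF b))
        (((dF v).fun_mul (dG u)).fun_sub ((dF u).fun_mul (dG v))),
      fderiv_fun_sub (dG a) (dF b)]
    rfl
  have hEF (w : V) := congrArg (fun f => fderiv ℂ f q w) (funext hLaxF)
  have hEG (w : V) := congrArg (fun f => fderiv ℂ f q w) (funext hLaxG)
  simp only [fderiv_bracket_apply (dF _) (dE _) (dF _) (dE _)] at hEF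
  simp only [fderiv_bracket_apply (dG _) (dE _) (dG _) (dE _)] at hEG
  simp only [hW, fderiv_bracket_apply (dF _) (dG _) (dF _) (dG _)]
  have hab := fderiv_fderiv_apply_comm hE a b q
  rw [hEG a, hEF b, fderiv_fderiv_apply_comm hE a u, fderiv_fderiv_apply_comm hE a v,
    fderiv_fderiv_apply_comm hE b u, fderiv_fderiv_apply_comm hE b v,
    hEF u, hEF v, hEG u, hEG v, fderiv_fderiv_apply_comm hG a u,
    fderiv_fderiv_apply_comm hG a v, fderiv_fderiv_apply_comm hF b u,
    fderiv_fderiv_apply_comm hF b v, fderiv_fderiv_apply_comm hE u v,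
    fderiv_fderiv_apply_comm hF u v, fderiv_fderiv_apply_comm hG u v] at hab
  rw [fderiv_fderiv_apply_comm hF u v, fderiv_fderiv_apply_comm hG u v]
  linear_combination hab

end DirectionalDerivative

/-- The Whitham hierarchy equations are the compatibility conditions of the system
`∂_A E = {E, Ω_A}`: the Poisson bracket of the Whitham expression `W_{AB}` with `E`
vanishes. -/
theorem whitham_compatibility {n : ℕ} (hn : 0 < n) (A B : Fin n)
    (ΩA ΩB E : ℂ × (Fin n → ℂ) → ℂ)
    (hΩA : ContDiff ℂ 2 ΩA) (hΩB : ContDiff ℂ 2 ΩB) (hE : ContDiff ℂ 2 E)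
    (hLaxA : ∀ q : ℂ × (Fin n → ℂ),
      tDeriv A E q = pDeriv ΩA q * tDeriv ⟨0, hn⟩ E q - tDeriv ⟨0, hn⟩ ΩA q * pDeriv E q)
    (hLaxB : ∀ q : ℂ × (Fin n → ℂ),
      tDeriv B E q = pDeriv ΩB q * tDeriv ⟨0, hn⟩ E q - tDeriv ⟨0, hn⟩ ΩB q * pDeriv E q)
    (q : ℂ × (Fin n → ℂ)) :
    pDeriv (fun r => tDeriv A ΩB r - tDeriv B ΩA r
        + tDeriv ⟨0, hn⟩ ΩA r * pDeriv ΩB r - pDeriv ΩA r * tDeriv ⟨0, hn⟩ ΩB r) q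
        * tDeriv ⟨0, hn⟩ E q
      - tDeriv ⟨0, hn⟩ (fun r => tDeriv A ΩB r - tDeriv B ΩA r
          + tDeriv ⟨0, hn⟩ ΩA r * pDeriv ΩB r - pDeriv ΩA r * tDeriv ⟨0, hn⟩ ΩB r) q
        * pDeriv E q = 0 := by
  exact bracket_compatibility (1, 0) (0, Pi.single (⟨0, hn⟩ : Fin n) 1) (0, Pi.single A 1)
    (0, Pi.single B 1) hΩA hΩB hE hLaxA hLaxB q
end
end

section
/- Suppose the time-dependent family Ω and the function Q both arise from a potential S: Ω_A(p, t) := (∂_{t_A} S)(E(p, t), t) for each A ∈ Fin n, and Q(p, t) := (∂_E S)(E(p, t), t), where ∂_E S denotes the partial derivative of S in its first slot. Then the 2-form ∑_A δΩ_A ∧ dt_A equals δE ∧ δQ: for every point q = (p, t) and all vectors u, v ∈ ℂ × (Fin n → ℂ), ∑_{A ∈ Fin n} (DΩ_A(q)(u) · (v.2 A) − DΩ_A(q)(v) · (u.2 A)) = DE(q)(u) · DQ(q)(v) − DE(q)(v) · DQ(q)(u), where D denotes the Fréchet derivative of the composite functions of (p, t). -/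
open scoped BigOperators

noncomputable section

theorem fderiv_fderiv_comp_apply {n : ℕ}
    {S : ℂ × (Fin n → ℂ) → ℂ} (hS : ContDiff ℂ 2 S)
    {E : ℂ × (Fin n → ℂ) → ℂ} (hE : Differentiable ℂ E) {f : ℂ × (Fin n → ℂ) → ℂ}
    {w : ℂ × (Fin n → ℂ)} (hf : ∀ q, f q = fderiv ℂ S (E q, q.2) w)
    (q u : ℂ × (Fin n → ℂ)) :
    fderiv ℂ f q u = fderiv ℂ (fderiv ℂ S) (E q, q.2) (fderiv ℂ E q u, u.2) w := by
  have hdS : Differentiable ℂ (fderiv ℂ S) :=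
    (hS.fderiv_right (m := 1) (by norm_num)).differentiable (by norm_num)
  have hg : HasFDerivAt (fun x : ℂ × (Fin n → ℂ) => (E x, x.2))
      ((fderiv ℂ E q).prod (ContinuousLinearMap.snd ℂ ℂ (Fin n → ℂ))) q :=
    (hE q).hasFDerivAt.prodMk hasFDerivAt_snd
  have h := ((hdS (E q, q.2)).hasFDerivAt.comp q hg).clm_apply (hasFDerivAt_const w q)
  have hd := (h.congr_of_eventuallyEq (Filter.Eventually.of_forall hf)).fderiv
  rw [hd]
  simp

theorem sum_apply_single_mul {n : ℕ} (L : ℂ × (Fin n → ℂ) →L[ℂ] ℂ) (t : Fin n → ℂ) :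
    ∑ A : Fin n, L (0, Pi.single A 1) * t A = L (0, t) := by
  have h := ((L.comp (ContinuousLinearMap.inr ℂ ℂ (Fin n → ℂ))).toLinearMap).pi_apply_eq_sum_univ t
  have hs (A : Fin n) : (fun j => if A = j then (1 : ℂ) else 0) = Pi.single A 1 := by
    ext j
    simp [Pi.single_apply, eq_comm]
  simpa [hs, mul_comm] using h.symm

/-- When the family `Ω_A = ∂_{t_A} S (E, t)` and `Q = ∂_E S (E, t)` arise from a
potential `S`, the 2-form `∑_A δΩ_A ∧ dt_A` equals `δE ∧ δQ`. -/
theorem whitham_potential_form {n : ℕ} (hn : 0 < n)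
    (S : ℂ × (Fin n → ℂ) → ℂ) (hS : ContDiff ℂ 2 S)
    (E : ℂ × (Fin n → ℂ) → ℂ) (hE : Differentiable ℂ E)
    (Ω : Fin n → ℂ × (Fin n → ℂ) → ℂ) (Q : ℂ × (Fin n → ℂ) → ℂ)
    (hΩ : ∀ A : Fin n, ∀ q : ℂ × (Fin n → ℂ),
      Ω A q = fderiv ℂ S (E q, q.2) ((0 : ℂ), Pi.single A (1 : ℂ)))
    (hQ : ∀ q : ℂ × (Fin n → ℂ),
      Q q = fderiv ℂ S (E q, q.2) ((1 : ℂ), (0 : Fin n → ℂ)))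
    (q u v : ℂ × (Fin n → ℂ)) :
    ∑ A : Fin n, (fderiv ℂ (Ω A) q u * v.2 A - fderiv ℂ (Ω A) q v * u.2 A) =
      fderiv ℂ E q u * fderiv ℂ Q q v - fderiv ℂ E q v * fderiv ℂ Q q u := by
  have hB : IsSymmSndFDerivAt ℂ S (E q, q.2) :=
    hS.contDiffAt.isSymmSndFDerivAt (by simp)
  have split (L : ℂ × (Fin n → ℂ) →L[ℂ] ℂ) (a : ℂ) (t : Fin n → ℂ) :
      L (a, t) = a * L (1, 0) + L (0, t) := by
    rw [← smul_eq_mul, ← map_smul, ← map_add]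
    simp
  simp only [fun A => fderiv_fderiv_comp_apply hS hE (hΩ A),
    fderiv_fderiv_comp_apply hS hE hQ, Finset.sum_sub_distrib, sum_apply_single_mul]
  have h := hB (fderiv ℂ E q u, u.2) (fderiv ℂ E q v, v.2)
  rw [split _ (fderiv ℂ E q v) v.2, split _ (fderiv ℂ E q u) u.2] at h
  linear_combination h
end
end

section
/- Let u, w : ℝ³ → ℝ be differentiable functions of (x, y, t). On ℝ⁴ with coordinates (p, x, y, t) define f₁(p,x,y,t) := p, f₂(p,x,y,t) := p²/2 + u(x,y,t), f₃(p,x,y,t) := p³/3 + p·u(x,y,t) + w(x,y,t), and the 2-form Π_q(v₁, v₂) := ∑_{i=1}^{3} (Df_i(q)(v₁)·(v₂)_{c_i} − Df_i(q)(v₂)·(v₁)_{c_i}), where c₁, c₂, c₃ denote the x-, y-, t-components of a vector. Then at every point q = (p,x,y,t): (Π∧Π)_q(e_p, e_x, e_y, e_t) = p·(∂_y u − ∂_x w) + (∂_y w − ∂_t u + u·∂_x u); consequently (Π∧Π)_q(v₁,v₂,v₃,v₄) = 0 for every point q and all vectors v₁,...,v₄ if and only if ∂_y u = ∂_x w and ∂_t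 u − u·∂_x u = ∂_y w hold everywhere on ℝ³. -/
noncomputable section

/-- Partial derivative in `x` on `ℝ³` with coordinates `(x, y, t)`. -/
def dX (f : ℝ × ℝ × ℝ → ℝ) (a : ℝ × ℝ × ℝ) : ℝ := fderiv ℝ f a (1, 0, 0)

/-- Partial derivative in `y` on `ℝ³` with coordinates `(x, y, t)`. -/
def dY (f : ℝ × ℝ × ℝ → ℝ) (a : ℝ × ℝ × ℝ) : ℝ := fderiv ℝ f a (0, 1, 0)

/-- Partial derivative in `t` on `ℝ³` with coordinates `(x, y, t)`. -/
def dT (f : ℝ × ℝ × ℝ → ℝ) (a : ℝ × ℝ × ℝ) : ℝ := fderiv ℝ f a (0, 0, 1)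

/-- `f₁(p,x,y,t) = p`. -/
def f₁ : ℝ × ℝ × ℝ × ℝ → ℝ := fun q => q.1

/-- `f₂(p,x,y,t) = p²/2 + u(x,y,t)`. -/
def f₂ (u : ℝ × ℝ × ℝ → ℝ) : ℝ × ℝ × ℝ × ℝ → ℝ := fun q => q.1 ^ 2 / 2 + u q.2

/-- `f₃(p,x,y,t) = p³/3 + p·u(x,y,t) + w(x,y,t)`. -/
def f₃ (u w : ℝ × ℝ × ℝ → ℝ) : ℝ × ℝ × ℝ × ℝ → ℝ :=
  fun q => q.1 ^ 3 / 3 + q.1 * u q.2 + w q.2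

/-- The dKP 2-form `Π = dx∧dp + dy∧d(p²/2+u) + dt∧d(p³/3+pu+w)` as an alternating
bilinear form on `ℝ⁴` with coordinates `(p, x, y, t)`. -/
def dKPForm (u w : ℝ × ℝ × ℝ → ℝ) (q v₁ v₂ : ℝ × ℝ × ℝ × ℝ) : ℝ :=
  (fderiv ℝ f₁ q v₁ * v₂.2.1 - fderiv ℝ f₁ q v₂ * v₁.2.1)
    + (fderiv ℝ (f₂ u) q v₁ * v₂.2.2.1 - fderiv ℝ (f₂ u) q v₂ * v₁.2.2.1)
    + (fderiv ℝ (f₃ u w) q v₁ * v₂.2.2.2 - fderiv ℝ (f₃ u w) q v₂ * v₁.2.2.2)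

/-- The wedge square `Π ∧ Π` of the dKP 2-form. -/
def dKPWedgeSq (u w : ℝ × ℝ × ℝ → ℝ) (q v₁ v₂ v₃ v₄ : ℝ × ℝ × ℝ × ℝ) : ℝ :=
  dKPForm u w q v₁ v₂ * dKPForm u w q v₃ v₄
    - dKPForm u w q v₁ v₃ * dKPForm u w q v₂ v₄
    + dKPForm u w q v₁ v₄ * dKPForm u w q v₂ v₃

/-- The Fréchet derivative of a function on `ℝ³` in terms of its partial derivatives. -/
lemma fderiv_apply_eq_partials (f : ℝ × ℝ × ℝ → ℝ) (a v : ℝ × ℝ × ℝ) :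
    fderiv ℝ f a v = v.1 * dX f a + v.2.1 * dY f a + v.2.2 * dT f a := by
  have hv : v = v.1 • ((1 : ℝ), (0 : ℝ), (0 : ℝ)) + v.2.1 • ((0 : ℝ), (1 : ℝ), (0 : ℝ))
      + v.2.2 • ((0 : ℝ), (0 : ℝ), (1 : ℝ)) := by
    ext <;> simp
  conv_lhs => rw [hv]
  simp only [map_add, map_smul, smul_eq_mul, dX, dY, dT]

lemma fderiv_f₁_apply (q v : ℝ × ℝ × ℝ × ℝ) : fderiv ℝ f₁ q v = v.1 := by
  have h : HasFDerivAt f₁ (ContinuousLinearMap.fst ℝ ℝ (ℝ × ℝ × ℝ)) q := hasFDerivAt_fst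
  simp [h.fderiv]

lemma fderiv_f₂_apply {u : ℝ × ℝ × ℝ → ℝ} (hu : Differentiable ℝ u) (q v : ℝ × ℝ × ℝ × ℝ) :
    fderiv ℝ (f₂ u) q v = q.1 * v.1 + fderiv ℝ u q.2 v.2 := by
  have hp := hasFDerivAt_fst (𝕜 := ℝ) (p := q)
  have hu' := (hu q.2).hasFDerivAt.comp q hasFDerivAt_snd
  have h : HasFDerivAt (𝕜 := ℝ) (f₂ u) _ q := ((hp.pow 2).mul_const (2⁻¹ : ℝ)).add hu'
  rw [h.fderiv]
  simp
  ring

lemma fderiv_f₃_apply {u w : ℝ × ℝ × ℝ → ℝ} (hu : Differentiable ℝ u) (hw : Differentiable ℝ w)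
    (q v : ℝ × ℝ × ℝ × ℝ) :
    fderiv ℝ (f₃ u w) q v =
      (q.1 ^ 2 + u q.2) * v.1 + q.1 * fderiv ℝ u q.2 v.2 + fderiv ℝ w q.2 v.2 := by
  have hp := hasFDerivAt_fst (𝕜 := ℝ) (p := q)
  have hu' := (hu q.2).hasFDerivAt.comp q hasFDerivAt_snd
  have hw' := (hw q.2).hasFDerivAt.comp q hasFDerivAt_snd
  have h : HasFDerivAt (𝕜 := ℝ) (f₃ u w) _ q :=
    (((hp.pow 3).mul_const (3⁻¹ : ℝ)).add (hp.mul hu')).add hw'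
  rw [h.fderiv]
  simp
  ring

/-- `Π ∧ Π` is its value on the coordinate frame times the volume form. -/
lemma dKPWedgeSq_eq_mul_det {u w : ℝ × ℝ × ℝ → ℝ} (hu : Differentiable ℝ u)
    (hw : Differentiable ℝ w) (q v₁ v₂ v₃ v₄ : ℝ × ℝ × ℝ × ℝ) :
    dKPWedgeSq u w q v₁ v₂ v₃ v₄ =
      (q.1 * (dY u q.2 - dX w q.2) + (dY w q.2 - dT u q.2 + u q.2 * dX u q.2)) *
        Matrix.det !![v₁.1, v₁.2.1, v₁.2.2.1, v₁.2.2.2; v₂.1, v₂.2.1, v₂.2.2.1, v₂.2.2.2;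
          v₃.1, v₃.2.1, v₃.2.2.1, v₃.2.2.2; v₄.1, v₄.2.1, v₄.2.2.1, v₄.2.2.2] := by
  simp only [dKPWedgeSq, dKPForm, fderiv_f₁_apply, fderiv_f₂_apply hu, fderiv_f₃_apply hu hw,
    fderiv_apply_eq_partials]
  simp [Matrix.det_succ_row_zero, Fin.sum_univ_succ, Fin.succAbove]
  ring

/-- The twistor form of the dKP equation: `Π ∧ Π` evaluated on the coordinate frame
equals `p(u_y − w_x) + (w_y − u_t + u u_x)`, and the simplicity `Π ∧ Π = 0`
is equivalent to the first-order dKP system. -/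
theorem dKP_wedge (u w : ℝ × ℝ × ℝ → ℝ)
    (hu : Differentiable ℝ u) (hw : Differentiable ℝ w) :
    (∀ q : ℝ × ℝ × ℝ × ℝ,
      dKPWedgeSq u w q ((1 : ℝ), (0 : ℝ), (0 : ℝ), (0 : ℝ))
          ((0 : ℝ), (1 : ℝ), (0 : ℝ), (0 : ℝ))
          ((0 : ℝ), (0 : ℝ), (1 : ℝ), (0 : ℝ))
          ((0 : ℝ), (0 : ℝ), (0 : ℝ), (1 : ℝ)) =
        q.1 * (dY u q.2 - dX w q.2) + (dY w q.2 - dT u q.2 + u q.2 * dX u q.2)) ∧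
    ((∀ q v₁ v₂ v₃ v₄ : ℝ × ℝ × ℝ × ℝ, dKPWedgeSq u w q v₁ v₂ v₃ v₄ = 0) ↔
      (∀ a : ℝ × ℝ × ℝ, dY u a = dX w a ∧ dT u a - u a * dX u a = dY w a)) := by
  have frame : ∀ q : ℝ × ℝ × ℝ × ℝ,
      dKPWedgeSq u w q ((1 : ℝ), (0 : ℝ), (0 : ℝ), (0 : ℝ))
          ((0 : ℝ), (1 : ℝ), (0 : ℝ), (0 : ℝ))
          ((0 : ℝ), (0 : ℝ), (1 : ℝ), (0 : ℝ))
          ((0 : ℝ), (0 : ℝ), (0 : ℝ), (1 : ℝ)) =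
        q.1 * (dY u q.2 - dX w q.2) + (dY w q.2 - dT u q.2 + u q.2 * dX u q.2) := by
    intro q
    simp [dKPWedgeSq_eq_mul_det hu hw, Matrix.det_succ_row_zero, Fin.sum_univ_succ, Fin.succAbove]
  refine ⟨frame, fun h a => ?_, fun h q v₁ v₂ v₃ v₄ => ?_⟩
  · have h₀ := (frame (0, a)).symm.trans (h _ _ _ _ _)
    have h₁ := (frame (1, a)).symm.trans (h _ _ _ _ _)
    simp only at h₀ h₁
    constructor <;> linarith
  · obtain ⟨h₁, h₂⟩ := h q.2
    rw [dKPWedgeSq_eq_mul_det hu hw, h₁, ← h₂]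
    ring
end
end
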